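/- Let A be a poset with least element ⊥ and greatest element ⊤, and let G be a premotive game with parity over A that has a left option H reversible through a right option K of H with K ≤ G. Let G' be the game obtained from G by bypassing this reversible option: G' = ⟨(left options of K) ∪ (left options of G other than H) | right options of G⟩, where if K = [k] is atomic, the set of left options of K is taken to be {⟨[⊥]|[k]⟩}. Then G' is premotive and has parity, and G ≃ G' in the intrinsic order. Moreover, if G is *-antimonotone, then G' is *-antimonotone. -/

import Mathlib

/-- Games over a poset `α`: atomic games `[a]` for `a : α`, and composite games
`⟨L|R⟩` given by nonempty families of left and right options. -/
inductive Game (α : Type) : Type 1 where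
  | atom : α → Game α
  | comp : (ι κ : Type) → (ι → Game α) → (κ → Game α) → Nonempty ι → Nonempty κ → Game α

namespace Game

variable {α β : Type}

/-- `G'` is a left option of the game. -/
def IsLeftOption (G' : Game α) : Game α → Prop
  | atom _ => False
  | comp _ _ L _ _ _ => ∃ i, L i = G'

/-- `G'` is a right option of the game. -/
def IsRightOption (G' : Game α) : Game α → Prop
  | atom _ => False
  | comp _ _ _ R _ _ => ∃ k, R k = G'

/-- `G'` is an option of `G`. -/
def IsOption (G' G : Game α) : Prop := IsLeftOption G' G ∨ IsRightOption G' G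

/-- A game is composite if it is not atomic. -/
def IsComposite : Game α → Prop
  | atom _ => False
  | comp _ _ _ _ _ _ => True

/-- `G'` is a follower of `G`: `G` itself, an option of `G`, or recursively a follower
of an option of `G`. -/
def IsFollower (G' G : Game α) : Prop := Relation.ReflTransGen IsOption G' G

/-- The dual game: Left and Right switch sides; it is a game over the opposite poset. -/
def dual : Game α → Game αᵒᵈ
  | atom a => atom (OrderDual.toDual a)
  | comp ι κ L R hι hκ => comp κ ι (fun k => (R k).dual) (fun i => (L i).dual) hκ hι

/-- The image of a game under a (monotone) function applied to atoms. -/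
def map (f : α → β) : Game α → Game β
  | atom a => atom (f a)
  | comp ι κ L R hι hκ => comp ι κ (fun i => (L i).map f) (fun k => (R k).map f) hι hκ

/-- The (disjunctive) sum of a game over `α` and a game over `β`, a game over `α × β`. -/
noncomputable def add : Game α → Game β → Game (α × β) := by
  intro G
  induction G with
  | atom g =>
    intro H
    induction H with
    | atom h => exact atom (g, h)
    | comp ι κ L R hι hκ IHL IHR => exact comp ι κ IHL IHR hι hκ
  | comp ι κ L R hι hκ IHL IHR =>
    intro H
    induction H with
    | atom h => exact comp ι κ (fun i => IHL i (atom h)) (fun k => IHR k (atom h)) hι hκ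
    | comp ι' κ' L' R' hι' hκ' IHL' IHR' =>
      exact comp (ι ⊕ ι') (κ ⊕ κ')
        (Sum.elim (fun i => IHL i (comp ι' κ' L' R' hι' hκ')) IHL')
        (Sum.elim (fun k => IHR k (comp ι' κ' L' R' hι' hκ')) IHR')
        (hι.elim fun i => ⟨Sum.inl i⟩) (hκ.elim fun k => ⟨Sum.inl k⟩)

mutual
/-- Left has a first player winning strategy in a game over the boolean poset:
either the game is the atom `⊤`, or some left option has a second player
winning strategy for Left. -/
inductive LeftWinsFirst : Game Bool → Prop where
  | atom_top : LeftWinsFirst (atom true)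
  | move {G G' : Game Bool} : IsLeftOption G' G → LeftWinsSecond G' → LeftWinsFirst G

/-- Left has a second player winning strategy in a game over the boolean poset:
every right option has a first player winning strategy for Left, and if the game
is atomic it is the atom `⊤`. -/
inductive LeftWinsSecond : Game Bool → Prop where
  | mk {G : Game Bool} : (∀ G', IsRightOption G' G → LeftWinsFirst G') →
      (∀ b, G = atom b → b = true) → LeftWinsSecond G
end

mutual
/-- A game is even if all of its options are odd (atomic games are even). -/
inductive Even {α : Type} : Game α → Prop where
  | mk {G : Game α} : (∀ G', IsOption G' G → Odd G') → Even G

/-- A game is odd if it is composite and all of its options are even. -/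
inductive Odd {α : Type} : Game α → Prop where
  | mk {G : Game α} : G.IsComposite → (∀ G', IsOption G' G → Even G') → Odd G
end

/-- A game has parity if it is even or odd. -/
def HasParity (G : Game α) : Prop := Even G ∨ Odd G

/-- `G` and `H` have matching parity (both even or both odd). -/
def MatchingParity (G H : Game α) : Prop := (Even G ∧ Even H) ∨ (Odd G ∧ Odd H)

/-- `G` and `H` have mismatching parity (one even, the other odd). -/
def MismatchParity (G H : Game α) : Prop := (Even G ∧ Odd H) ∨ (Odd G ∧ Even H)

mutual
/-- The intrinsic order `G ≤ H` on games over a poset: every left option `G^L` of `G`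
satisfies `G^L ◁ H`, every right option `H^R` of `H` satisfies `G ◁ H^R`, and if
both games are atoms `[g]`, `[h]` then `g ≤ h`. -/
inductive Le {α : Type} [PartialOrder α] : Game α → Game α → Prop where
  | mk {G H : Game α} :
      (∀ G', IsLeftOption G' G → Tri G' H) →
      (∀ H', IsRightOption H' H → Tri G H') →
      (∀ g h, G = atom g → H = atom h → g ≤ h) →
      Le G H

/-- The intrinsic relation `G ◁ H` on games over a poset: some right option `G^R` of `G`
satisfies `G^R ≤ H`, or some left option `H^L` of `H` satisfies `G ≤ H^L`. -/
inductive Tri {α : Type} [PartialOrder α] : Game α → Game α → Prop where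
  | inr {G H G' : Game α} : IsRightOption G' G → Le G' H → Tri G H
  | inl {G H H' : Game α} : IsLeftOption H' H → Le G H' → Tri G H
end

/-- The comparison game `λ(Gᵒᵖ + H)`, a game over the boolean poset, where
`λ : αᵒᵈ × α → 𝔹` is the monotone map with `λ(xᵒᵖ, y) = ⊤` iff `x ≤ y`. -/
noncomputable def comparison [PartialOrder α] (G H : Game α) : Game Bool :=
  map (fun p : αᵒᵈ × α => @decide (OrderDual.ofDual p.1 ≤ p.2) (Classical.propDecidable _))
    (G.dual.add H)

/-- A game is locally premotive if Left has a first player winning strategy in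
the comparison game `λ(Gᵒᵖ + G)`. -/
def LocallyPremotive [PartialOrder α] (G : Game α) : Prop := LeftWinsFirst (comparison G G)

/-- A game is premotive if it and all of its followers are locally premotive. -/
def Premotive [PartialOrder α] (G : Game α) : Prop :=
  ∀ G', IsFollower G' G → LocallyPremotive G'

/-- The game `* = ⟨0|0⟩` over the one-element poset. -/
def star : Game Unit := comp Unit Unit (fun _ => atom ()) (fun _ => atom ()) ⟨()⟩ ⟨()⟩

/-- `G + *`, identified with a game over `α` via the isomorphism `α × 1 ≅ α`. -/
noncomputable def addStar (G : Game α) : Game α := map Prod.fst (G.add star)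

/-- A game is locally `*`-antimonotone if `G^L + * ≤ G ≤ G^R + *` for all left and
right options `G^L`, `G^R`. -/
def LocallyStarAnti [PartialOrder α] (G : Game α) : Prop :=
  (∀ G', IsLeftOption G' G → Le G'.addStar G) ∧ (∀ G', IsRightOption G' G → Le G G'.addStar)

/-- A game is `*`-antimonotone if it and all of its followers are locally
`*`-antimonotone. -/
def StarAnti [PartialOrder α] (G : Game α) : Prop :=
  ∀ G', IsFollower G' G → LocallyStarAnti G'

/-- `ε(G + X)`: the game `G` over `α` embedded in a context `X`, a game over the poset
`[α, 𝔹]` of monotone functions `α → 𝔹`, via the application map `ε(a, f) = f a`. -/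
noncomputable def ctxSum [PartialOrder α] (G : Game α) (X : Game (α →o Bool)) : Game Bool :=
  map (fun p : α × (α →o Bool) => p.2 p.1) (G.add X)

/-- The outcome `(o_L(G), o_R(G)) ∈ 𝔹 × 𝔹` of a game over the boolean poset:
`o_L(G) = ⊤` iff Left has a first player winning strategy and `o_R(G) = ⊤` iff
Left has a second player winning strategy. -/
noncomputable def outcome (G : Game Bool) : Bool × Bool :=
  (@decide (LeftWinsFirst G) (Classical.propDecidable _),
   @decide (LeftWinsSecond G) (Classical.propDecidable _))

/-- The contextual order `G ≤_c H`: `o(G+X) ≤ o(H+X)` for every context `X`. -/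
def ContextualLe [PartialOrder α] (G H : Game α) : Prop :=
  ∀ X : Game (α →o Bool), outcome (ctxSum G X) ≤ outcome (ctxSum H X)

/-- The contextual relation `G ◁_c H`: `o_R(G+X) ≤ o_L(H+X)` for every context `X`. -/
def ContextualTri [PartialOrder α] (G H : Game α) : Prop :=
  ∀ X : Game (α →o Bool), (outcome (ctxSum G X)).2 ≤ (outcome (ctxSum H X)).1

/-- Two games are identical when they are equal as set-based games: both are the same
atom, or both are composite with identical sets of left options and identical sets of
right options (recursively). -/
def Identical : Game α → Game α → Prop
  | atom a, atom b => a = b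
  | comp _ _ L R _ _, comp _ _ L' R' _ _ =>
      ((∀ i, ∃ i', Identical (L i) (L' i')) ∧ (∀ i', ∃ i, Identical (L i) (L' i'))) ∧
      ((∀ k, ∃ k', Identical (R k) (R' k')) ∧ (∀ k', ∃ k, Identical (R k) (R' k')))
  | _, _ => False

/-- The index type for the left options contributed by `K` when bypassing a
reversible left option through `K`. -/
def bypassIdx : Game α → Type
  | atom _ => Unit
  | comp ι _ _ _ _ _ => ι

/-- The left options contributed by `K` when bypassing a reversible left option
through `K`: the left options of `K` if `K` is composite, and the single game
`⟨[⊥]|[k]⟩` if `K = [k]` is atomic. -/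
def bypassLeft [PartialOrder α] [OrderBot α] : (K : Game α) → K.bypassIdx → Game α
  | atom k, _ => comp Unit Unit (fun _ => atom ⊥) (fun _ => atom k) ⟨()⟩ ⟨()⟩
  | comp _ _ L _ _ _, i => L i

theorem bypassIdx_nonempty : ∀ K : Game α, Nonempty K.bypassIdx
  | atom _ => ⟨()⟩
  | comp _ _ _ _ hι _ => hι

theorem opt_ind {P : Game α → Prop} (h : ∀ G, (∀ G', IsOption G' G → P G') → P G) :
    ∀ G, P G := by
  intro G
  induction G with
  | atom a => exact h _ (by rintro G' (h | h) <;> exact h.elim)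
  | comp ι κ L R hι hκ ihL ihR =>
    apply h
    rintro G' (⟨i, rfl⟩ | ⟨i, rfl⟩)
    · exact ihL i
    · exact ihR i

/-- Parity indexed by a boolean. -/
def Par (a : Bool) (G : Game α) : Prop := if a then Even G else Odd G

theorem Par.opt {a : Bool} {G G' : Game α} (h : Par a G) (ho : IsOption G' G) : Par (!a) G' := by
  cases a with
  | true => cases h with | mk h => exact h _ ho
  | false => cases h with | mk _ h => exact h _ ho

theorem Par.left {a : Bool} {G G' : Game α} (h : Par a G) (ho : IsLeftOption G' G) :
    Par (!a) G' := h.opt (Or.inl ho)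

theorem Par.right {a : Bool} {G G' : Game α} (h : Par a G) (ho : IsRightOption G' G) :
    Par (!a) G' := h.opt (Or.inr ho)

theorem Par.not_not {a : Bool} {G : Game α} (h : Par (!(!a)) G) : Par a G := by
  simpa using h

theorem Par.not_not' {a : Bool} {G : Game α} (h : Par a G) : Par (!(!a)) G := by
  simpa using h

theorem par_atom {a : Bool} {g : α} (h : Par a (atom g)) : a = true := by
  cases a with
  | true => rfl
  | false => cases h with | mk h _ => exact h.elim

theorem par_true_atom (g : α) : Par true (atom g) :=
  Even.mk (by rintro G' (h | h) <;> exact h.elim)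

theorem par_mk {a : Bool} {ι κ : Type} {L : ι → Game α} {R : κ → Game α} {hι hκ}
    (hL : ∀ i, Par (!a) (L i)) (hR : ∀ i, Par (!a) (R i)) : Par a (comp ι κ L R hι hκ) := by
  cases a with
  | true => exact Even.mk (by rintro G' (⟨i, rfl⟩ | ⟨i, rfl⟩); exacts [hL i, hR i])
  | false => exact Odd.mk trivial (by rintro G' (⟨i, rfl⟩ | ⟨i, rfl⟩); exacts [hL i, hR i])

section order
variable [PartialOrder α]

/-- Left wins the comparison game moving first. -/
def W1 (G H : Game α) : Prop := LeftWinsFirst (comparison G H)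
/-- Left wins the comparison game moving second. -/
def W2 (G H : Game α) : Prop := LeftWinsSecond (comparison G H)

theorem left_comparison (G H : Game α) (X : Game Bool) : IsLeftOption X (comparison G H) ↔
    (∃ G', IsRightOption G' G ∧ comparison G' H = X) ∨
    (∃ H', IsLeftOption H' H ∧ comparison G H' = X) := by
  cases G with
  | atom g =>
    cases H with
    | atom h => 
      constructor
      · intro h; exact h.elim
      · rintro (⟨_, h, _⟩ | ⟨_, h, _⟩) <;> exact h.elim
    | comp ι κ L R hι hκ =>
      constructor
      · rintro ⟨i, rfl⟩; exact Or.inr ⟨_, ⟨i, rfl⟩, rfl⟩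
      · rintro (⟨_, h, _⟩ | ⟨_, ⟨i, rfl⟩, rfl⟩)
        · exact h.elim
        · exact ⟨i, rfl⟩
  | comp ι' κ' L' R' hι' hκ' =>
    cases H with
    | atom h =>
      constructor
      · rintro ⟨i, rfl⟩; exact Or.inl ⟨_, ⟨i, rfl⟩, rfl⟩
      · rintro (⟨_, ⟨i, rfl⟩, rfl⟩ | ⟨_, h, _⟩)
        · exact ⟨i, rfl⟩
        · exact h.elim
    | comp ι κ L R hι hκ =>
      constructor
      · rintro ⟨i | i, rfl⟩
        · exact Or.inl ⟨_, ⟨i, rfl⟩, rfl⟩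
        · exact Or.inr ⟨_, ⟨i, rfl⟩, rfl⟩
      · rintro (⟨_, ⟨i, rfl⟩, rfl⟩ | ⟨_, ⟨i, rfl⟩, rfl⟩)
        · exact ⟨Sum.inl i, rfl⟩
        · exact ⟨Sum.inr i, rfl⟩

theorem right_comparison (G H : Game α) (X : Game Bool) : IsRightOption X (comparison G H) ↔
    (∃ G', IsLeftOption G' G ∧ comparison G' H = X) ∨
    (∃ H', IsRightOption H' H ∧ comparison G H' = X) := by
  cases G with
  | atom g =>
    cases H with
    | atom h => 
      constructor
      · intro h; exact h.elim
      · rintro (⟨_, h, _⟩ | ⟨_, h, _⟩) <;> exact h.elim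
    | comp ι κ L R hι hκ =>
      constructor
      · rintro ⟨i, rfl⟩; exact Or.inr ⟨_, ⟨i, rfl⟩, rfl⟩
      · rintro (⟨_, h, _⟩ | ⟨_, ⟨i, rfl⟩, rfl⟩)
        · exact h.elim
        · exact ⟨i, rfl⟩
  | comp ι' κ' L' R' hι' hκ' =>
    cases H with
    | atom h =>
      constructor
      · rintro ⟨i, rfl⟩; exact Or.inl ⟨_, ⟨i, rfl⟩, rfl⟩
      · rintro (⟨_, ⟨i, rfl⟩, rfl⟩ | ⟨_, h, _⟩)
        · exact ⟨i, rfl⟩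
        · exact h.elim
    | comp ι κ L R hι hκ =>
      constructor
      · rintro ⟨i | i, rfl⟩
        · exact Or.inl ⟨_, ⟨i, rfl⟩, rfl⟩
        · exact Or.inr ⟨_, ⟨i, rfl⟩, rfl⟩
      · rintro (⟨_, ⟨i, rfl⟩, rfl⟩ | ⟨_, ⟨i, rfl⟩, rfl⟩)
        · exact ⟨Sum.inl i, rfl⟩
        · exact ⟨Sum.inr i, rfl⟩

theorem comparison_atom (G H : Game α) (b : Bool) : comparison G H = atom b ↔
    ∃ g h, G = atom g ∧ H = atom h ∧ (b = true ↔ g ≤ h) := by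
  cases G with
  | atom g =>
    cases H with
    | atom h =>
      have : comparison (atom g) (atom h) =
        atom (@decide (g ≤ h) (Classical.propDecidable _)) := rfl
      rw [this]
      constructor
      · intro h'
        injection h' with h'
        exact ⟨g, h, rfl, rfl, by rw [← h']; simp⟩
      · rintro ⟨g', h', h1, h2, h3⟩
        injection h1 with h1
        injection h2 with h2
        subst h1 h2
        congr 1
        rw [Bool.eq_iff_iff, h3]; simp
    | comp ι κ L R hι hκ =>
      constructor
      · intro h; exact Game.noConfusion rfl (heq_of_eq h)
      · rintro ⟨_, _, _, h, _⟩; cases h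
  | comp ι κ L R hι hκ =>
    constructor
    · intro h; cases H <;> exact Game.noConfusion rfl (heq_of_eq h)
    · rintro ⟨_, _, h, _, _⟩; cases h

theorem W1_iff {G H : Game α} : W1 G H ↔ (∃ G', IsRightOption G' G ∧ W2 G' H) ∨
    (∃ H', IsLeftOption H' H ∧ W2 G H') ∨ (∃ g h, G = atom g ∧ H = atom h ∧ g ≤ h) := by
  constructor
  · intro h
    unfold W1 at h
    generalize hX : comparison G H = X at h
    cases h with
    | atom_top =>
      obtain ⟨g, h, h1, h2, h3⟩ := (comparison_atom G H true).1 hX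
      exact Or.inr (Or.inr ⟨g, h, h1, h2, h3.1 rfl⟩)
    | move ho hw =>
      subst hX
      rcases (left_comparison _ _ _).1 ho with ⟨G', h, rfl⟩ | ⟨G', h, rfl⟩
      · exact Or.inl ⟨G', h, hw⟩
      · exact Or.inr (Or.inl ⟨G', h, hw⟩)
  · rintro (⟨G', h, hw⟩ | ⟨G', h, hw⟩ | ⟨g, h, h1, h2, h3⟩)
    · exact LeftWinsFirst.move ((left_comparison _ _ _).2 (Or.inl ⟨_, h, rfl⟩)) hw
    · exact LeftWinsFirst.move ((left_comparison _ _ _).2 (Or.inr ⟨_, h, rfl⟩)) hw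
    · unfold W1
      rw [(comparison_atom G H true).2 ⟨g, h, h1, h2, by simp [h3]⟩]
      exact LeftWinsFirst.atom_top

theorem W2_iff {G H : Game α} : W2 G H ↔ (∀ G', IsLeftOption G' G → W1 G' H) ∧
    (∀ H', IsRightOption H' H → W1 G H') ∧ (∀ g h, G = atom g → H = atom h → g ≤ h) := by
  constructor
  · rintro ⟨h1, h2⟩
    refine ⟨fun G' h => h1 _ ((right_comparison _ _ _).2 (Or.inl ⟨_, h, rfl⟩)),
      fun G' h => h1 _ ((right_comparison _ _ _).2 (Or.inr ⟨_, h, rfl⟩)), fun g h hg hh => ?_⟩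
    by_contra hn
    have := h2 false ((comparison_atom _ _ _).2 ⟨g, h, hg, hh, by simp [hn]⟩)
    simp at this
  · rintro ⟨h1, h2, h3⟩
    refine LeftWinsSecond.mk ?_ ?_
    · intro X hX
      rcases (right_comparison _ _ _).1 hX with ⟨G', h, rfl⟩ | ⟨G', h, rfl⟩
      · exact h1 _ h
      · exact h2 _ h
    · intro b hb
      obtain ⟨g, h, hg, hh, hb⟩ := (comparison_atom _ _ _).1 hb
      exact hb.2 (h3 g h hg hh)

theorem W1.atoms {g h : α} (w : W1 (atom g) (atom h)) : g ≤ h := by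
  rcases W1_iff.1 w with ⟨_, h, _⟩ | ⟨_, h, _⟩ | ⟨g', h', h1, h2, h3⟩
  · exact h.elim
  · exact h.elim
  · cases h1; cases h2; exact h3

theorem W1.mkAtoms {g h : α} (w : g ≤ h) : W1 (atom g) (atom h) :=
  W1_iff.2 (Or.inr (Or.inr ⟨g, h, rfl, rfl, w⟩))

theorem W1.mkR {G G' H : Game α} (h : IsRightOption G' G) (w : W2 G' H) : W1 G H :=
  W1_iff.2 (Or.inl ⟨_, h, w⟩)

theorem W1.mkL {G H' H : Game α} (h : IsLeftOption H' H) (w : W2 G H') : W1 G H :=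
  W1_iff.2 (Or.inr (Or.inl ⟨_, h, w⟩))

theorem W2.l {G G' H : Game α} (w : W2 G H) (h : IsLeftOption G' G) : W1 G' H :=
  (W2_iff.1 w).1 _ h

theorem W2.r {G H' H : Game α} (w : W2 G H) (h : IsRightOption H' H) : W1 G H' :=
  (W2_iff.1 w).2.1 _ h

theorem Le.l {G G' H : Game α} (w : Le G H) (h : IsLeftOption G' G) : Tri G' H := by
  cases w with | mk a b c => exact a _ h

theorem Le.r {G H' H : Game α} (w : Le G H) (h : IsRightOption H' H) : Tri G H' := by
  cases w with | mk a b c => exact b _ h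

theorem Le.a {g h : α} (w : Le (atom g) (atom h)) : g ≤ h := by
  cases w with | mk a b c => exact c _ _ rfl rfl

theorem tri_iff {G H : Game α} : Tri G H ↔ (∃ G', IsRightOption G' G ∧ Le G' H) ∨
    (∃ H', IsLeftOption H' H ∧ Le G H') := by
  constructor
  · intro h
    cases h with
    | inr a b => exact Or.inl ⟨_, a, b⟩
    | inl a b => exact Or.inr ⟨_, a, b⟩
  · rintro (⟨_, a, b⟩ | ⟨_, a, b⟩)
    · exact Tri.inr a b
    · exact Tri.inl a b

theorem tri_atom {G : Game α} {h : α} (w : Tri G (atom h)) :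
    ∃ G', IsRightOption G' G ∧ Le G' (atom h) := by
  rcases tri_iff.1 w with h | ⟨_, h, _⟩
  · exact h
  · exact h.elim

theorem atom_tri {G : Game α} {h : α} (w : Tri (atom h) G) :
    ∃ G', IsLeftOption G' G ∧ Le (atom h) G' := by
  rcases tri_iff.1 w with ⟨_, h, _⟩ | h
  · exact h.elim
  · exact h

theorem le_refl' : ∀ G : Game α, Le G G := by
  apply opt_ind
  intro G ih
  refine Le.mk (fun G' h => Tri.inl h (ih _ (Or.inl h))) (fun G' h => Tri.inr h (ih _ (Or.inr h)))
    ?_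
  rintro g h rfl h2
  cases h2; exact le_rfl

theorem atoms_le {g h : α} (hgh : g ≤ h) : Le (atom g) (atom h) := by
  refine Le.mk (fun _ h => h.elim) (fun _ h => h.elim) ?_
  intro _ _ h1 h2
  cases h1; cases h2; exact hgh

theorem le_mono {h k : α} (hk : h ≤ k) : ∀ G : Game α, (Le G (atom h) → Le G (atom k)) ∧
    (Tri G (atom h) → Tri G (atom k)) := by
  apply opt_ind
  intro G ih
  refine ⟨fun w => Le.mk (fun G' ho => (ih _ (Or.inl ho)).2 (w.l ho)) (fun _ h => h.elim) ?_, ?_⟩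
  · rintro g k' rfl h2
    cases h2
    exact w.a.trans hk
  · intro w
    obtain ⟨G', ho, w⟩ := tri_atom w
    exact Tri.inr ho ((ih _ (Or.inr ho)).1 w)

theorem le_mono' {h k : α} (hk : k ≤ h) : ∀ G : Game α, (Le (atom h) G → Le (atom k) G) ∧
    (Tri (atom h) G → Tri (atom k) G) := by
  apply opt_ind
  intro G ih
  refine ⟨fun w => Le.mk (fun _ h => h.elim) (fun G' ho => (ih _ (Or.inr ho)).2 (w.r ho)) ?_, ?_⟩
  · rintro g k' h2 rfl
    cases h2
    exact hk.trans w.a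
  · intro w
    obtain ⟨G', ho, w⟩ := atom_tri w
    exact Tri.inl ho ((ih _ (Or.inl ho)).1 w)

/-- Hereditary property used on the left of a composition. -/
def HP1 (G : Game α) : Prop := ∀ F, IsFollower F G → Par true F →
  ∀ h, Le F (atom h) → W1 F (atom h)

/-- Hereditary property used on the right of a composition. -/
def HP2 (G : Game α) : Prop := ∀ F, IsFollower F G → Par true F →
  ∀ h, Le (atom h) F → W1 (atom h) F

theorem HP1.opt {G G' : Game α} (h : HP1 G) (ho : IsOption G' G) : HP1 G' :=
  fun F hF => h F (hF.tail ho)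

theorem HP2.opt {G G' : Game α} (h : HP2 G) (ho : IsOption G' G) : HP2 G' :=
  fun F hF => h F (hF.tail ho)

theorem follower_cases {F G : Game α} (h : IsFollower F G) :
    F = G ∨ ∃ G', IsOption G' G ∧ IsFollower F G' := by
  rcases Relation.ReflTransGen.cases_tail h with h | ⟨G', h1, h2⟩
  · exact Or.inl h.symm
  · exact Or.inr ⟨G', h2, h1⟩

theorem follower_atom {F : Game α} {g : α} (h : IsFollower F (atom g)) : F = atom g := by
  rcases follower_cases h with h | ⟨G', h | h, _⟩
  · exact h
  · exact h.elim
  · exact h.elim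

theorem hp1_atom (g : α) : HP1 (atom g) := by
  intro F hF _ h w
  rw [follower_atom hF] at w ⊢
  exact W1.mkAtoms w.a

theorem hp2_atom (g : α) : HP2 (atom g) := by
  intro F hF _ h w
  rw [follower_atom hF] at w ⊢
  exact W1.mkAtoms w.a

theorem comp1 : ∀ H G K : Game α, HP1 G → ∀ a : Bool,
    (Par a G → Par a H → Par (!a) K → Le G H → W2 H K → W2 G K) ∧
    (Par a G → Par (!a) H → Par a K → Tri G H → W2 H K → W1 G K) ∧
    (Par a G → Par a H → Par a K → Le G H → W1 H K → W1 G K) := by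
  intro H
  induction H using opt_ind with | h H ihH
  intro G
  induction G using opt_ind with | h G ihG
  intro K
  induction K using opt_ind with | h K ihK
  intro hG a
  refine ⟨fun pG pH pK w v => W2_iff.2 ⟨fun G' ho => ?_, fun K' ho => ?_, ?_⟩, ?_, ?_⟩
  · exact (ihG G' (Or.inl ho) K (hG.opt (Or.inl ho)) (!a)).2.1 (pG.left ho) pH.not_not' pK
      (w.l ho) v
  · exact (ihK K' (Or.inr ho) hG a).2.2 pG pH (pK.right ho).not_not w (v.r ho)
  · rintro g k rfl rfl
    have := par_atom pG
    have := par_atom pK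
    simp_all
  · intro pG pH pK w v
    rcases tri_iff.1 w with ⟨G', ho, w⟩ | ⟨H', ho, w⟩
    · exact W1.mkR ho ((ihG G' (Or.inr ho) K (hG.opt (Or.inr ho)) (!a)).1 (pG.right ho) pH
        pK.not_not' w v)
    · exact (ihH H' (Or.inl ho) G K hG a).2.2 pG (pH.left ho).not_not pK w (v.l ho)
  · intro pG pH pK w v
    rcases W1_iff.1 v with ⟨H', ho, v⟩ | ⟨K', ho, v⟩ | ⟨h, k, rfl, rfl, hk⟩
    · exact (ihH H' (Or.inr ho) G K hG a).2.1 pG (pH.right ho) pK (w.r ho) v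
    · exact W1.mkL ho ((ihK K' (Or.inl ho) hG a).1 pG pH (pK.left ho) w v)
    · obtain rfl := par_atom pH
      exact hG G .refl pG k ((le_mono hk G).1 w)

theorem comp2 : ∀ H G K : Game α, HP2 K → ∀ a : Bool,
    (Par (!a) G → Par a H → Par a K → W2 G H → Le H K → W2 G K) ∧
    (Par a G → Par (!a) H → Par a K → W2 G H → Tri H K → W1 G K) ∧
    (Par a G → Par a H → Par a K → W1 G H → Le H K → W1 G K) := by
  intro H
  induction H using opt_ind with | h H ihH
  intro G
  induction G using opt_ind with | h G ihG
  intro K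
  induction K using opt_ind with | h K ihK
  intro hK a
  refine ⟨fun pG pH pK w v => W2_iff.2 ⟨fun G' ho => ?_, fun K' ho => ?_, ?_⟩, ?_, ?_⟩
  · exact (ihG G' (Or.inl ho) K hK a).2.2 (pG.left ho).not_not pH pK (w.l ho) v
  · exact (ihK K' (Or.inr ho) (hK.opt (Or.inr ho)) (!a)).2.1 pG pH.not_not' (pK.right ho) w (v.r ho)
  · rintro g k rfl rfl
    have := par_atom pG
    have := par_atom pK
    simp_all
  · intro pG pH pK w v
    rcases tri_iff.1 v with ⟨H', ho, v⟩ | ⟨K', ho, v⟩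
    · exact (ihH H' (Or.inr ho) G K hK a).2.2 pG (pH.right ho).not_not pK (w.r ho) v
    · exact W1.mkL ho ((ihK K' (Or.inl ho) (hK.opt (Or.inl ho)) (!a)).1 pG.not_not' pH
        (pK.left ho) w v)
  · intro pG pH pK w v
    rcases W1_iff.1 w with ⟨G', ho, w⟩ | ⟨H', ho, w⟩ | ⟨g, h, rfl, rfl, hk⟩
    · exact W1.mkR ho ((ihG G' (Or.inr ho) K hK a).1 (pG.right ho) pH pK w v)
    · exact (ihH H' (Or.inl ho) G K hK a).2.1 pG (pH.left ho) pK w (v.l ho)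
    · obtain rfl := par_atom pH
      exact hK K .refl pK g ((le_mono' hk K).1 v)

theorem p1_of_local {G : Game α} (pG : Par true G) (hG : LocallyPremotive G) (h : α)
    (w : Le G (atom h)) : W1 G (atom h) := by
  rcases W1_iff.1 hG with ⟨G', ho, v⟩ | ⟨G', ho, v⟩ | ⟨g, _, rfl, _, _⟩
  · exact W1.mkR ho ((comp2 G G' (atom h) (hp2_atom h) true).1 (pG.right ho) pG
      (par_true_atom h) v w)
  · obtain ⟨G'', ho', w'⟩ := tri_atom (w.l ho)
    exact (comp2 G'' G (atom h) (hp2_atom h) true).2.2 pG ((pG.left ho).right ho').not_not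
      (par_true_atom h) (v.r ho') w'
  · exact W1.mkAtoms w.a

theorem p2_of_local {G : Game α} (pG : Par true G) (hG : LocallyPremotive G) (h : α)
    (w : Le (atom h) G) : W1 (atom h) G := by
  rcases W1_iff.1 hG with ⟨G', ho, v⟩ | ⟨G', ho, v⟩ | ⟨g, _, rfl, _, _⟩
  · obtain ⟨G'', ho', w'⟩ := atom_tri (w.r ho)
    exact (comp1 G'' (atom h) G (hp1_atom h) true).2.2 (par_true_atom h)
      ((pG.right ho).left ho').not_not pG w' (v.l ho')
  · exact W1.mkL ho ((comp1 G (atom h) G' (hp1_atom h) true).1 (par_true_atom h) pG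
      (pG.left ho) w v)
  · exact W1.mkAtoms w.a

theorem Premotive.opt {G G' : Game α} (h : Premotive G) (ho : IsOption G' G) : Premotive G' :=
  fun F hF => h F (hF.tail ho)

theorem trans_all : ∀ H G K : Game α, Premotive H → ∀ a : Bool,
    (Par a G → Par a H → Par a K → Le G H → Le H K → Le G K) ∧
    (Par (!a) G → Par a H → Par a K → Tri G H → Le H K → Tri G K) ∧
    (Par a G → Par a H → Par (!a) K → Le G H → Tri H K → Tri G K) := by
  intro H
  induction H using opt_ind with | h H ihH
  intro G
  induction G using opt_ind with | h G ihG
  intro K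
  induction K using opt_ind with | h K ihK
  intro hH a
  refine ⟨fun pG pH pK w v => Le.mk (fun G' ho => ?_) (fun K' ho => ?_) ?_, ?_, ?_⟩
  · exact (ihG G' (Or.inl ho) K hH a).2.1 (pG.left ho) pH pK (w.l ho) v
  · exact (ihK K' (Or.inr ho) hH a).2.2 pG pH (pK.right ho) w (v.r ho)
  · rintro g k rfl rfl
    obtain rfl := par_atom pG
    have h1 := p1_of_local pH (hH _ .refl) k v
    exact ((comp1 H (atom g) (atom k) (hp1_atom g) true).2.2 pG pH pK w h1).atoms
  · intro pG pH pK w v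
    rcases tri_iff.1 w with ⟨G', ho, w⟩ | ⟨H', ho, w⟩
    · exact Tri.inr ho ((ihG G' (Or.inr ho) K hH a).1 (pG.right ho).not_not pH pK w v)
    · exact (ihH H' (Or.inl ho) G K (hH.opt (Or.inl ho)) (!a)).2.2 pG (pH.left ho) pK.not_not'
        w (v.l ho)
  · intro pG pH pK w v
    rcases tri_iff.1 v with ⟨H', ho, v⟩ | ⟨K', ho, v⟩
    · exact (ihH H' (Or.inr ho) G K (hH.opt (Or.inr ho)) (!a)).2.1 pG.not_not' (pH.right ho) pK
        (w.r ho) v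
    · exact Tri.inl ho ((ihK K' (Or.inl ho) hH a).1 pG pH (pK.left ho).not_not w v)

theorem le_trans' {G H K : Game α} {a : Bool} (hH : Premotive H) (pG : Par a G) (pH : Par a H)
    (pK : Par a K) (w : Le G H) (v : Le H K) : Le G K :=
  (trans_all H G K hH a).1 pG pH pK w v

end order

theorem add_zero_map : ∀ G : Game α, map Prod.fst (G.add (atom ())) = G := by
  intro G
  induction G with
  | atom g => rfl
  | comp ι κ L R hι hκ ihL ihR =>
    have : map Prod.fst ((comp ι κ L R hι hκ).add (atom ())) =
      comp ι κ (fun i => map Prod.fst ((L i).add (atom ())))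
        (fun i => map Prod.fst ((R i).add (atom ()))) hι hκ := rfl
    rw [this]
    simp only [ihL, ihR]

theorem left_addStar {G X : Game α} (h : IsLeftOption X G.addStar) :
    X = G ∨ ∃ G', IsLeftOption G' G ∧ X = G'.addStar := by
  cases G with
  | atom g => obtain ⟨i, rfl⟩ := h; exact Or.inl rfl
  | comp ι κ L R hι hκ =>
    obtain ⟨i | i, rfl⟩ := h
    · exact Or.inr ⟨L i, ⟨i, rfl⟩, rfl⟩
    · exact Or.inl (add_zero_map (comp ι κ L R hι hκ))

theorem right_addStar {G X : Game α} (h : IsRightOption X G.addStar) :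
    X = G ∨ ∃ G', IsRightOption G' G ∧ X = G'.addStar := by
  cases G with
  | atom g => obtain ⟨i, rfl⟩ := h; exact Or.inl rfl
  | comp ι κ L R hι hκ =>
    obtain ⟨i | i, rfl⟩ := h
    · exact Or.inr ⟨R i, ⟨i, rfl⟩, rfl⟩
    · exact Or.inl (add_zero_map (comp ι κ L R hι hκ))

theorem self_left_addStar (G : Game α) : IsLeftOption G G.addStar := by
  cases G with
  | atom g => exact ⟨(), rfl⟩
  | comp ι κ L R hι hκ => exact ⟨Sum.inr (), add_zero_map (comp ι κ L R hι hκ)⟩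

theorem self_right_addStar (G : Game α) : IsRightOption G G.addStar := by
  cases G with
  | atom g => exact ⟨(), rfl⟩
  | comp ι κ L R hι hκ => exact ⟨Sum.inr (), add_zero_map (comp ι κ L R hι hκ)⟩

theorem addStar_comp (G : Game α) : ¬ ∃ g, G.addStar = atom g := by
  rintro ⟨g, h⟩
  have := self_left_addStar G
  rw [h] at this
  exact this.elim

theorem par_of_opts {a : Bool} {G : Game α} (hc : ¬ ∃ g, G = atom g)
    (h : ∀ G', IsOption G' G → Par (!a) G') : Par a G := by
  cases G with
  | atom g => exact (hc ⟨g, rfl⟩).elim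
  | comp ι κ L R hι hκ => exact par_mk (fun i => h _ (Or.inl ⟨i, rfl⟩)) fun i => h _ (Or.inr ⟨i, rfl⟩)

theorem par_addStar : ∀ (G : Game α) (a : Bool), Par a G → Par (!a) G.addStar := by
  apply opt_ind
  intro G ih a pG
  refine par_of_opts (addStar_comp G) ?_
  rintro X (h | h)
  · rcases left_addStar h with rfl | ⟨G', ho, rfl⟩
    · exact pG.not_not'
    · exact ih _ (Or.inl ho) _ (pG.left ho)
  · rcases right_addStar h with rfl | ⟨G', ho, rfl⟩
    · exact pG.not_not'
    · exact ih _ (Or.inr ho) _ (pG.right ho)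

/-- The game `⟨[⊥]|[k]⟩`. -/
def botK [PartialOrder α] [OrderBot α] (k : α) : Game α :=
  comp Unit Unit (fun _ => atom ⊥) (fun _ => atom k) ⟨()⟩ ⟨()⟩

theorem atom_premotive [PartialOrder α] (k : α) : Premotive (atom k) := by
  intro F hF
  rw [follower_atom hF]
  exact W1.mkAtoms le_rfl

section bot
variable [PartialOrder α] [OrderBot α]

theorem botK_left (k : α) : IsLeftOption (atom ⊥) (botK k) := ⟨(), rfl⟩
theorem botK_right (k : α) : IsRightOption (atom k) (botK k) := ⟨(), rfl⟩

theorem w2_botK {h k : α} (hk : h ≤ k) : W2 (atom h) (botK k) := by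
  refine W2_iff.2 ⟨fun _ h => h.elim, ?_, ?_⟩
  · rintro _ ⟨_, rfl⟩
    exact W1.mkAtoms hk
  · intro _ _ _ h; cases h

theorem botK_premotive (k : α) : Premotive (botK k) := by
  intro F hF
  rcases follower_cases hF with rfl | ⟨G', ⟨_, rfl⟩ | ⟨_, rfl⟩, h⟩
  · exact W1.mkR (botK_right k) (w2_botK le_rfl)
  · exact atom_premotive _ _ h
  · exact atom_premotive _ _ h

theorem atom_starAnti (k : α) : StarAnti (atom k) := by
  intro F hF
  rw [follower_atom hF]
  exact ⟨fun _ h => h.elim, fun _ h => h.elim⟩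

theorem not_addStar_atom {P : Prop} {G : Game α} {g : α} (h : G.addStar = atom g) : P :=
  (addStar_comp G ⟨g, h⟩).elim

theorem botK_starAnti (k : α) : StarAnti (botK k) := by
  intro F hF
  rcases follower_cases hF with rfl | ⟨G', ⟨_, rfl⟩ | ⟨_, rfl⟩, h⟩
  · constructor
    · rintro _ ⟨_, rfl⟩
      refine Le.mk ?_ ?_ ?_
      · intro X hX
        rcases left_addStar hX with rfl | ⟨_, h, _⟩
        · exact Tri.inl (botK_left k) (le_refl' _)
        · exact h.elim
      · rintro _ ⟨_, rfl⟩
        exact Tri.inr (self_right_addStar _) (atoms_le bot_le)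
      · intro _ _ h; exact not_addStar_atom h
    · rintro _ ⟨_, rfl⟩
      refine Le.mk ?_ ?_ ?_
      · rintro _ ⟨_, rfl⟩
        exact Tri.inl (self_left_addStar _) (atoms_le bot_le)
      · intro X hX
        rcases right_addStar hX with rfl | ⟨_, h, _⟩
        · exact Tri.inr (botK_right k) (le_refl' _)
        · exact h.elim
      · intro _ _ _ h; exact not_addStar_atom h
  · exact atom_starAnti _ _ h
  · exact atom_starAnti _ _ h

theorem botK_par (k : α) : Par false (botK k) :=
  par_mk (fun _ => par_true_atom _) (fun _ => par_true_atom _)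

theorem botK_addStar_le (k : α) : Le (botK k).addStar (atom k) := by
  refine Le.mk ?_ (fun _ h => h.elim) ?_
  · intro X hX
    rcases left_addStar hX with rfl | ⟨_, ⟨_, rfl⟩, rfl⟩
    · exact Tri.inr (botK_right k) (le_refl' _)
    · exact Tri.inr (self_right_addStar _) (atoms_le bot_le)
  · intro _ _ h; exact not_addStar_atom h

theorem bypass_core {G G' H K : Game α} {a : Bool}
    (cG : ¬ ∃ g, G = atom g) (cG' : ¬ ∃ g, G' = atom g)
    (hH : IsLeftOption H G) (hK : IsRightOption K H) (hKG : Le K G)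
    (hprem : Premotive G) (pG : Par a G)
    (F1 : ∀ X, IsLeftOption X K → IsLeftOption X G')
    (F2 : ∀ k, K = atom k → IsLeftOption (botK k) G')
    (F3 : ∀ X, IsLeftOption X G' → IsLeftOption X K ∨ (∃ k, K = atom k ∧ X = botK k) ∨
      IsLeftOption X G)
    (F4 : ∀ X, IsLeftOption X G → X = H ∨ IsLeftOption X G')
    (F5 : ∀ X, IsRightOption X G' ↔ IsRightOption X G) :
    Premotive G' ∧ HasParity G' ∧ Le G G' ∧ Le G' G ∧ (StarAnti G → StarAnti G') := by
  have pH : Par (!a) H := pG.left hH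
  have pK : Par a K := (pH.right hK).not_not
  have premK : Premotive K := (hprem.opt (Or.inl hH)).opt (Or.inr hK)
  have pG' : Par a G' := by
    refine par_of_opts cG' ?_
    rintro X (h | h)
    · rcases F3 X h with h | ⟨k, rfl, rfl⟩ | h
      · exact pK.left h
      · obtain rfl := par_atom pK
        exact botK_par k
      · exact pG.left h
    · exact pG.right ((F5 X).1 h)
  have leKG' : Le K G' := by
    refine Le.mk (fun X h => Tri.inl (F1 X h) (le_refl' _)) (fun X h => hKG.r ((F5 X).1 h)) ?_
    intro _ g _ h; exact (cG' ⟨g, h⟩).elim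
  have le1 : Le G G' := by
    refine Le.mk (fun X h => ?_) (fun X h => Tri.inr ((F5 X).1 h) (le_refl' _)) ?_
    · rcases F4 X h with rfl | h
      · exact Tri.inr hK leKG'
      · exact Tri.inl h (le_refl' _)
    · intro g _ h; exact (cG ⟨g, h⟩).elim
  have le2 : Le G' G := by
    refine Le.mk (fun X h => ?_) (fun X h => Tri.inr ((F5 X).2 h) (le_refl' _)) ?_
    · rcases F3 X h with h | ⟨k, rfl, rfl⟩ | h
      · exact hKG.l h
      · exact Tri.inr (botK_right k) hKG
      · exact Tri.inl h (le_refl' _)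
    · intro g _ h; exact (cG' ⟨g, h⟩).elim
  -- options of `G'` are premotive
  have optPrem : ∀ X, IsOption X G' → Premotive X := by
    rintro X (h | h)
    · rcases F3 X h with h | ⟨k, rfl, rfl⟩ | h
      · exact premK.opt (Or.inl h)
      · exact botK_premotive k
      · exact hprem.opt (Or.inl h)
    · exact hprem.opt (Or.inr ((F5 X).1 h))
  have q1 : a = true → ∀ h, Le G' (atom h) → W1 G' (atom h) := by
    rintro rfl h w
    have hKh : Le K (atom h) := by
      refine Le.mk (fun X ho => w.l (F1 X ho)) (fun _ h => h.elim) ?_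
      rintro k h' rfl e
      cases e
      obtain ⟨_, ⟨_, rfl⟩, v⟩ := tri_atom (w.l (F2 k rfl))
      exact v.a
    have w' : Le G (atom h) := by
      refine Le.mk (fun X ho => ?_) (fun _ h => h.elim) ?_
      · rcases F4 X ho with rfl | ho
        · exact Tri.inr hK hKh
        · exact w.l ho
      · intro g _ h; exact (cG ⟨g, h⟩).elim
    rcases W1_iff.1 (p1_of_local pG (hprem _ .refl) h w') with ⟨X, ho, v⟩ | ⟨_, ho, _⟩ | ⟨g, _, e, _⟩
    · exact W1.mkR ((F5 X).2 ho) v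
    · exact ho.elim
    · exact (cG ⟨g, e⟩).elim
  have q2 : a = true → ∀ h, Le (atom h) G' → W1 (atom h) G' := by
    rintro rfl h w
    have w' : Le (atom h) G := by
      refine Le.mk (fun _ h => h.elim) (fun X ho => w.r ((F5 X).2 ho)) ?_
      intro _ g _ h; exact (cG ⟨g, h⟩).elim
    rcases W1_iff.1 (p2_of_local pG (hprem _ .refl) h w') with ⟨_, ho, _⟩ | ⟨X, ho, v⟩ | ⟨_, g, _, e, _⟩
    · exact ho.elim
    · rcases F4 X ho with rfl | ho
      · rcases W1_iff.1 (v.r hK) with ⟨_, ho, _⟩ | ⟨Y, ho, v⟩ | ⟨_, k, e, rfl, hk⟩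
        · exact ho.elim
        · exact W1.mkL (F1 Y ho) v
        · cases e
          exact W1.mkL (F2 k rfl) (w2_botK hk)
      · exact W1.mkL ho v
    · exact (cG ⟨g, e⟩).elim
  have parTrue : Par true G' → a = true := by
    intro h
    cases a with
    | true => rfl
    | false =>
      exfalso
      -- a composite game has both kinds of options; follow down to an atom
      have key : ∀ X : Game α, ¬ (Par true X ∧ Par false X) := by
        intro X
        induction X using opt_ind with | h X ih
        rintro ⟨h1, h2⟩
        cases X with
        | atom x => simpa using par_atom h2
        | comp ι κ L R hι hκ =>
          obtain ⟨i⟩ := hι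
          exact ih (L i) (Or.inl ⟨i, rfl⟩) ⟨h2.left ⟨i, rfl⟩, h1.left ⟨i, rfl⟩⟩
      exact key _ ⟨h, pG'⟩
  have hp1 : HP1 G' := by
    intro F hF pF
    rcases follower_cases hF with rfl | ⟨X, ho, hF⟩
    · exact q1 (parTrue pF)
    · exact p1_of_local pF (optPrem X ho F hF)
  have hp2 : HP2 G' := by
    intro F hF pF
    rcases follower_cases hF with rfl | ⟨X, ho, hF⟩
    · exact q2 (parTrue pF)
    · exact p2_of_local pF (optPrem X ho F hF)
  have loc : LocallyPremotive G' := by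
    rcases W1_iff.1 (hprem _ .refl) with ⟨X, ho, v⟩ | ⟨X, ho, v⟩ | ⟨g, _, e, _⟩
    · exact W1.mkR ((F5 X).2 ho) ((comp2 G X G' hp2 a).1 (pG.right ho) pG pG' v le1)
    · have v' : W2 G' X := (comp1 G G' X hp1 a).1 pG' pG (pG.left ho) le2 v
      rcases F4 X ho with rfl | ho
      · exact (comp2 K G' G' hp2 a).2.2 pG' pK pG' (v'.r hK) leKG'
      · exact W1.mkL ho v'
    · exact (cG ⟨g, e⟩).elim
  refine ⟨?_, ?_, le1, le2, ?_⟩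
  · intro F hF
    rcases follower_cases hF with rfl | ⟨X, ho, hF⟩
    · exact loc
    · exact optPrem X ho F hF
  · cases a with
    | true => exact Or.inl pG'
    | false => exact Or.inr pG'
  · intro hs F hF
    rcases follower_cases hF with rfl | ⟨X, ho, hF⟩
    · constructor
      · intro X hX
        have pX : Par a X.addStar := (par_addStar X _ (pG'.left hX)).not_not
        rcases F3 X hX with h | ⟨k, rfl, rfl⟩ | h
        · exact le_trans' premK pX pK pG'
            ((hs K (Relation.ReflTransGen.tail (b := H)
              (Relation.ReflTransGen.single (Or.inr hK)) (Or.inl hH))).1 X h) leKG'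
        · exact le_trans' premK pX pK pG' (botK_addStar_le k) leKG'
        · exact le_trans' hprem pX pG pG' ((hs G .refl).1 X h) le1
      · intro X hX
        have pX : Par a X.addStar := (par_addStar X _ (pG'.right hX)).not_not
        exact le_trans' hprem pG' pG pX le2 ((hs G .refl).2 X ((F5 X).1 hX))
    · rcases ho with h | h
      · rcases F3 X h with h | ⟨k, rfl, rfl⟩ | h
        · exact hs F (((hF.tail (Or.inl h)).tail (Or.inr hK)).tail (Or.inl hH))
        · exact botK_starAnti k F hF
        · exact hs F (hF.tail (Or.inl h))
      · exact hs F (hF.tail (Or.inr ((F5 X).1 h)))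

end bot

/-- Bypassing a reversible left option. Let `G = ⟨{H} ∪ L | R⟩` be a
premotive game with parity whose left option `H = Lf i₀` is reversible through a
right option `K` of `H` with `K ≤ G`, and let `G'` be the game obtained by bypassing
this reversible option: its left options are the left options of `K` (taken to be
`{⟨[⊥]|[k]⟩}` when `K = [k]` is atomic) together with the left options of `G` other
than `H`, and its right options are those of `G`. Then `G'` is premotive and has
parity, `G ≃ G'`, and if `G` is `*`-antimonotone then so is `G'`. -/
theorem bypass_reversible {α : Type} [PartialOrder α] [OrderBot α] [OrderTop α]
    {ι κ : Type} (Lf : ι → Game α) (Rf : κ → Game α) (hι : Nonempty ι) (hκ : Nonempty κ)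
    (i₀ : ι) (K : Game α) (hK : IsRightOption K (Lf i₀))
    (hKG : Le K (comp ι κ Lf Rf hι hκ))
    (hprem : Premotive (comp ι κ Lf Rf hι hκ))
    (hpar : HasParity (comp ι κ Lf Rf hι hκ)) :
    let G : Game α := comp ι κ Lf Rf hι hκ
    let G' : Game α := comp (K.bypassIdx ⊕ {i : ι // Lf i ≠ Lf i₀}) κ
      (Sum.elim (bypassLeft K) (fun i => Lf i.1)) Rf
      ((bypassIdx_nonempty K).elim fun j => ⟨Sum.inl j⟩) hκ
    Premotive G' ∧ HasParity G' ∧ Le G G' ∧ Le G' G ∧ (StarAnti G → StarAnti G') := by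
  intro G G'
  have hp : ∃ a, Par a G := by
    rcases hpar with h | h
    · exact ⟨true, h⟩
    · exact ⟨false, h⟩
  obtain ⟨a, pG⟩ := hp
  refine bypass_core (G := G) (G' := G') (H := Lf i₀) (K := K) (a := a)
    (fun ⟨_, h⟩ => Game.noConfusion rfl (heq_of_eq h))
    (fun ⟨_, h⟩ => Game.noConfusion rfl (heq_of_eq h)) ⟨i₀, rfl⟩ hK hKG hprem pG
    ?_ ?_ ?_ ?_ (fun X => Iff.rfl)
  · intro X hX
    cases K with
    | atom k => exact hX.elim
    | comp ι' κ' L' R' hι' hκ' =>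
      obtain ⟨i, rfl⟩ := hX
      exact ⟨Sum.inl i, rfl⟩
  · rintro k rfl
    exact ⟨Sum.inl (), rfl⟩
  · rintro X ⟨j | i, rfl⟩
    · cases K with
      | atom k => exact Or.inr (Or.inl ⟨k, rfl, rfl⟩)
      | comp ι' κ' L' R' hι' hκ' => exact Or.inl ⟨j, rfl⟩
    · exact Or.inr (Or.inr ⟨i.1, rfl⟩)
  · rintro X ⟨i, rfl⟩
    by_cases h : Lf i = Lf i₀
    · exact Or.inl h
    · exact Or.inr ⟨Sum.inr ⟨i, h⟩, rfl⟩

end Game
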